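/- Let R be a Noetherian commutative ring with unity, λ a length function on R-modules, S = R[x₁,…,x_k], and let 0 → A → B → C → 0 be an exact sequence of S-modules with B locally λ_R-finite. Then μ(B) = μ(A) ⊕ μ(C), where μ of an arbitrary S-module is defined as the supremum of μ(M') over all λ_S-small S-submodules M', the supremum of a family of monomials rᵢt^{dᵢ} being r·t^d with d the maximum of the dᵢ and r the supremum of the rᵢ with dᵢ = d, and where r·tⁿ ⊕ s·tᵐ := r·tⁿ if n > m, s·tᵐ if n < m, and (r+s)·tⁿ if n = m. -/

import Mathlib

open scoped ENNReal

/-- A (generalized) length function on the category of `R`-modules, with values in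
`ℝ≥0 ∪ {∞} = ℝ≥0∞`: it vanishes on the zero module, is invariant under isomorphism, is additive
on short exact sequences (equivalently, `λ(M) = λ(N) + λ(M/N)` for every submodule `N ≤ M`), and
is the supremum of its values on finitely generated submodules. -/
structure LengthFunction (R : Type) [CommRing R] : Type 1 where
  l : (M : Type) → [AddCommGroup M] → [Module R M] → ℝ≥0∞
  l_zero : ∀ (M : Type) [AddCommGroup M] [Module R M], Subsingleton M → l M = 0
  l_congr : ∀ (M N : Type) [AddCommGroup M] [Module R M] [AddCommGroup N] [Module R N],
      (M ≃ₗ[R] N) → l M = l N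
  l_add : ∀ (M : Type) [AddCommGroup M] [Module R M] (N : Submodule R M),
      l M = l N + l (M ⧸ N)
  l_fg_sup : ∀ (M : Type) [AddCommGroup M] [Module R M],
      l M = ⨆ (N : Submodule R M) (_ : N.FG), l N

/-- `Sₙ · V`: the `R`-submodule of `M` generated by the products `p • v` with `p ∈ Sₙ` (the
polynomials of total degree at most `n` in `S = R[x₁,…,x_k]`) and `v ∈ V`. -/
def degSmul {R : Type} [CommRing R] (k : ℕ) {M : Type} [AddCommGroup M] [Module R M]
    [Module (MvPolynomial (Fin k) R) M] [IsScalarTower R (MvPolynomial (Fin k) R) M]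
    (n : ℕ) (V : Submodule R M) : Submodule R M :=
  Submodule.span R
    {m : M | ∃ p ∈ MvPolynomial.restrictTotalDegree (Fin k) R n, ∃ v ∈ V, p • v = m}

variable {R : Type} [CommRing R]

open Filter

/-- `μ(M)` for a λ_S-small module `M`, as a pair (degree, coefficient) in `ℕ × ℝ≥0∞`:
the leading monomial of the Hilbert polynomial `q` with `q(n) = λ(Sₙ·V₀)` for `n` large, where
`V₀` is a finitely generated `R`-submodule of finite length with `S·V₀ = M` (by the Hilbert
polynomial theorem, this does not depend on the choices). -/
noncomputable def muSmall (k : ℕ) (L : LengthFunction R) (M : Type) [AddCommGroup M] [Module R M]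
    [Module (MvPolynomial (Fin k) R) M] [IsScalarTower R (MvPolynomial (Fin k) R) M] :
    ℕ × ℝ≥0∞ := by
  classical
  exact if h : ∃ (V : Submodule R M) (q : Polynomial ℝ),
      V.FG ∧ L.l V < ⊤ ∧ Submodule.span (MvPolynomial (Fin k) R) (V : Set M) = ⊤ ∧
        (∀ᶠ n : ℕ in atTop, (L.l (degSmul k n V)).toReal = q.eval (n : ℝ))
  then ((h.choose_spec.choose.natDegree),
        ENNReal.ofReal h.choose_spec.choose.leadingCoeff)
  else (0, 0)

/-- An `S`-module is λ_S-small if it is finitely generated as an `S`-module and locally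
λ_R-finite (every finitely generated `R`-submodule has finite length). -/
def IsSmall (k : ℕ) (L : LengthFunction R) (M : Type) [AddCommGroup M] [Module R M]
    [Module (MvPolynomial (Fin k) R) M] [IsScalarTower R (MvPolynomial (Fin k) R) M] : Prop :=
  Module.Finite (MvPolynomial (Fin k) R) M ∧ ∀ V : Submodule R M, V.FG → L.l V < ⊤

/-- The supremum of a family of monomials `rᵢ t^{dᵢ}` (as pairs (degree, coefficient)):
its degree `d` is the maximum of the `dᵢ` and its coefficient is the supremum of the `rᵢ`
with `dᵢ = d` (and it is `0 = (0,0)` for the empty family). -/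
noncomputable def monSup (I : Set (ℕ × ℝ≥0∞)) : ℕ × ℝ≥0∞ :=
  (sSup (Prod.fst '' I), sSup {r | (sSup (Prod.fst '' I), r) ∈ I})

/-- The sum `r·tⁿ ⊕ s·tᵐ` of two monomials (with coefficients in `ℝ≥0 ∪ {∞}`):
`r·tⁿ` if `n > m`, `s·tᵐ` if `n < m`, and `(r+s)·tⁿ` if `n = m`. -/
noncomputable def mOplusE (a b : ℕ × ℝ≥0∞) : ℕ × ℝ≥0∞ :=
  if b.1 < a.1 then a else if a.1 < b.1 then b else (a.1, a.2 + b.2)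

/-- `μ(M)` for an arbitrary `S`-module `M`: the supremum of `μ(M')` over all λ_S-small
`S`-submodules `M' ≤ M`. -/
noncomputable def muGen (k : ℕ) (L : LengthFunction R) (M : Type) [AddCommGroup M] [Module R M]
    [Module (MvPolynomial (Fin k) R) M] [IsScalarTower R (MvPolynomial (Fin k) R) M] :
    ℕ × ℝ≥0∞ :=
  monSup {m | ∃ M' : Submodule (MvPolynomial (Fin k) R) M, IsSmall k L M' ∧ m = muSmall k L M'}

section Polynomial

open Polynomial

lemma natDegree_bernoulli_le (n : ℕ) : (Polynomial.bernoulli n).natDegree ≤ n := by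
  rw [Polynomial.natDegree_le_iff_coeff_eq_zero]
  intro i hi
  rw [Polynomial.coeff_bernoulli, if_neg (by omega)]

lemma exists_eval_add_one_sub_eval {m : ℕ} {q : ℝ[X]} (hq : q ∈ degreeLT ℝ m) :
    ∃ Q ∈ degreeLT ℝ (m + 1), ∀ n : ℕ,
      Q.eval ((n + 1 : ℕ) : ℝ) - Q.eval (n : ℝ) = q.eval (n : ℝ) := by
  rcases Nat.eq_zero_or_pos m with rfl | hm
  · have hq0 : q = 0 := by simpa [Nat.WithBot.lt_zero_iff] using mem_degreeLT.1 hq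
    exact ⟨0, Submodule.zero_mem _, by simp [hq0]⟩
  refine ⟨∑ i ∈ Finset.range m,
    C (q.coeff i / (i + 1)) * (Polynomial.bernoulli (i + 1)).map (algebraMap ℚ ℝ),
    Submodule.sum_mem _ fun i hi => ?_, fun n => ?_⟩
  · rw [mem_degreeLT]
    rw [← smul_eq_C_mul]
    refine lt_of_le_of_lt (degree_smul_le _ _) ?_
    refine lt_of_le_of_lt degree_map_le (lt_of_le_of_lt degree_le_natDegree ?_)
    have := natDegree_bernoulli_le (i + 1)
    have := Finset.mem_range.1 hi
    exact_mod_cast (by omega)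
  · have key (i : ℕ) : ((Polynomial.bernoulli (i + 1)).map (algebraMap ℚ ℝ)).eval ((n + 1 : ℕ) : ℝ)
        - ((Polynomial.bernoulli (i + 1)).map (algebraMap ℚ ℝ)).eval (n : ℝ)
        = (i + 1) * (n : ℝ) ^ i := by
      have h := bernoulli_eval_one_add (i + 1) (n : ℚ)
      have h1 := eval_map_algebraMap (R := ℚ) (B := ℝ) (Polynomial.bernoulli (i + 1))
      have e1 : ((n + 1 : ℕ) : ℝ) = algebraMap ℚ ℝ (1 + n) := by simp [add_comm]
      have e2 : (n : ℝ) = algebraMap ℚ ℝ n := by simp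
      rw [e1, h1, aeval_algebraMap_apply, coe_aeval_eq_eval, h, e2, h1, aeval_algebraMap_apply,
        coe_aeval_eq_eval]
      simp
    have hd : q.degree < m := mem_degreeLT.1 hq
    rw [eval_eq_sum_range' (n := m) (p := q), eval_finsetSum, eval_finsetSum,
      ← Finset.sum_sub_distrib]
    · refine Finset.sum_congr rfl fun i _ => ?_
      rw [eval_C_mul, eval_C_mul, ← mul_sub, key]
      field_simp
    · rcases eq_or_ne q 0 with rfl | h0
      · simpa using hm
      · exact (natDegree_lt_iff_degree_lt h0).2 hd

/-- The function `h` eventually agrees with a real polynomial of degree less than `m`. -/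
def EventuallyPoly (m : ℕ) (h : ℕ → ℝ) : Prop :=
  ∃ q ∈ degreeLT ℝ m, ∀ᶠ n : ℕ in atTop, h n = q.eval (n : ℝ)

lemma comp_X_add_C_mem_degreeLT {m : ℕ} {q : ℝ[X]} (a : ℝ) (hq : q ∈ degreeLT ℝ m) :
    q.comp (X + C a) ∈ degreeLT ℝ m := by
  rw [mem_degreeLT] at hq ⊢
  rcases eq_or_ne q 0 with rfl | h0
  · simp
  · refine lt_of_le_of_lt degree_le_natDegree ?_
    rw [natDegree_comp, natDegree_X_add_C, mul_one]
    exact_mod_cast (natDegree_lt_iff_degree_lt h0).2 hq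

lemma EventuallyPoly.sub {m : ℕ} {h h' : ℕ → ℝ} :
    EventuallyPoly m h → EventuallyPoly m h' → EventuallyPoly m (fun n => h n - h' n) := by
  rintro ⟨q, hq, hh⟩ ⟨q', hq', hh'⟩
  refine ⟨q - q', Submodule.sub_mem _ hq hq', ?_⟩
  filter_upwards [hh, hh'] with n h1 h2
  rw [h1, h2, eval_sub]

lemma EventuallyPoly.shift {m : ℕ} {h : ℕ → ℝ} :
    EventuallyPoly m h → EventuallyPoly m (fun n => h (n + 1)) := by
  rintro ⟨q, hq, hh⟩
  refine ⟨q.comp (X + C 1), comp_X_add_C_mem_degreeLT 1 hq, ?_⟩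
  filter_upwards [(tendsto_add_atTop_nat 1).eventually hh] with n h1
  simpa using h1

lemma EventuallyPoly.of_forward_sub {m : ℕ} {h : ℕ → ℝ}
    (H : EventuallyPoly m (fun n => h (n + 1) - h n)) : EventuallyPoly (m + 1) h := by
  obtain ⟨q, hq, hh⟩ := H
  obtain ⟨Q, hQ, hQq⟩ := exists_eval_add_one_sub_eval hq
  obtain ⟨N, hN⟩ := eventually_atTop.1 hh
  refine ⟨Q + C (h N - Q.eval (N : ℝ)), Submodule.add_mem _ hQ ?_, ?_⟩
  · rw [mem_degreeLT]
    exact lt_of_le_of_lt degree_C_le (by exact_mod_cast Nat.succ_pos m)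
  · refine eventually_atTop.2 ⟨N, fun n hn => ?_⟩
    induction n, hn using Nat.le_induction with
    | base => simp
    | succ n hn ih =>
      have h1 := hN n hn
      have h2 := hQq n
      simp only [eval_add, eval_C] at ih ⊢
      linarith

/-- The leading monomial of a real polynomial, as a pair (degree, coefficient). -/
noncomputable def leadMonomial (q : ℝ[X]) : ℕ × ℝ≥0∞ :=
  (q.natDegree, ENNReal.ofReal q.leadingCoeff)

lemma leadMonomial_comp_X_add_C (q : ℝ[X]) (a : ℝ) :
    leadMonomial (q.comp (X + C a)) = leadMonomial q := by
  rw [leadMonomial, leadMonomial, natDegree_comp, leadingCoeff_comp (by simp)]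
  simp

lemma leadingCoeff_nonneg_of_eventually {q : ℝ[X]}
    (h : ∀ᶠ n : ℕ in atTop, 0 ≤ q.eval (n : ℝ)) : 0 ≤ q.leadingCoeff := by
  by_contra! hq
  by_cases hd : 0 < q.degree
  · have h1 := (tendsto_atBot_of_leadingCoeff_nonpos q hd hq.le).comp
      (tendsto_natCast_atTop_atTop (R := ℝ))
    obtain ⟨n, h2, h3⟩ := (h.and (h1.eventually (eventually_lt_atBot 0))).exists
    exact absurd h2 (not_le.2 h3)
  · rw [eq_C_of_degree_le_zero (not_lt.1 hd)] at h hq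
    obtain ⟨n, hn⟩ := h.exists
    simp only [eval_C, leadingCoeff_C] at hn hq
    linarith

lemma leadMonomial_add {p q : ℝ[X]} (hp : 0 ≤ p.leadingCoeff) (hq : 0 ≤ q.leadingCoeff) :
    leadMonomial (p + q) = mOplusE (leadMonomial p) (leadMonomial q) := by
  unfold mOplusE leadMonomial
  dsimp only
  split_ifs with h1 h2
  · have := degree_lt_degree h1
    rw [natDegree_add_eq_left_of_natDegree_lt h1, leadingCoeff_add_of_degree_lt' this]
  · have := degree_lt_degree h2
    rw [natDegree_add_eq_right_of_natDegree_lt h2, leadingCoeff_add_of_degree_lt this]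
  · have hd : p.natDegree = q.natDegree := by omega
    rw [← ENNReal.ofReal_add hp hq]
    have hc : (p + q).coeff p.natDegree = p.leadingCoeff + q.leadingCoeff := by
      rw [coeff_add, leadingCoeff, leadingCoeff, hd]
    have hle : (p + q).natDegree ≤ p.natDegree :=
      (natDegree_add_le p q).trans (by simp [hd])
    rcases eq_or_ne (p.leadingCoeff + q.leadingCoeff) 0 with h0 | h0
    · have hp0 : p = 0 := leadingCoeff_eq_zero.1 (by linarith)
      have hq0 : q = 0 := leadingCoeff_eq_zero.1 (by linarith)
      simp [hp0, hq0]
    · have e : (p + q).natDegree = p.natDegree :=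
        natDegree_eq_of_le_of_coeff_ne_zero hle (by rwa [hc])
      rw [leadingCoeff, e, hc]

/-- The order on monomials: compare degrees first, then coefficients. -/
def monLE (a b : ℕ × ℝ≥0∞) : Prop := a.1 < b.1 ∨ a.1 = b.1 ∧ a.2 ≤ b.2

lemma monLE.antisymm {a b : ℕ × ℝ≥0∞} (h : monLE a b) (h' : monLE b a) : a = b := by
  rcases h with h | ⟨h, h1⟩ <;> rcases h' with h' | ⟨h', h1'⟩
  · omega
  · omega
  · omega
  · exact Prod.ext h (le_antisymm h1 h1')

lemma monLE.trans {a b c : ℕ × ℝ≥0∞} (h : monLE a b) (h' : monLE b c) : monLE a c := by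
  rcases h with h | ⟨h, h1⟩ <;> rcases h' with h' | ⟨h', h1'⟩
  · exact Or.inl (h.trans h')
  · exact Or.inl (h' ▸ h)
  · exact Or.inl (h ▸ h')
  · exact Or.inr ⟨h.trans h', h1.trans h1'⟩

lemma monLE_mOplusE_left (a b : ℕ × ℝ≥0∞) : monLE a (mOplusE a b) := by
  unfold mOplusE monLE
  split_ifs with h1 h2
  · exact Or.inr ⟨rfl, le_rfl⟩
  · exact Or.inl h2
  · exact Or.inr ⟨rfl, le_self_add⟩

lemma mOplusE_comm (a b : ℕ × ℝ≥0∞) : mOplusE a b = mOplusE b a := by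
  unfold mOplusE
  split_ifs with h1 h2 h2
  · omega
  · rfl
  · rfl
  · rw [add_comm, show a.1 = b.1 by omega]

lemma mOplusE_mono {a a' b b' : ℕ × ℝ≥0∞} (h : monLE a a') (h' : monLE b b') :
    monLE (mOplusE a b) (mOplusE a' b') := by
  obtain ⟨a, r⟩ := a
  obtain ⟨a', r'⟩ := a'
  obtain ⟨b, s⟩ := b
  obtain ⟨b', s'⟩ := b'
  have e1 : r ≤ r' → r ≤ r' + s' := fun h => h.trans le_self_add
  have e2 : s ≤ s' → s ≤ r' + s' := fun h => h.trans le_add_self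
  have e3 : r ≤ r' → s ≤ s' → r + s ≤ r' + s' := fun h h' => add_le_add h h'
  unfold monLE at h h'
  unfold mOplusE monLE
  dsimp only at h h' ⊢
  split_ifs <;> dsimp only <;> grind

lemma monLE_monSup {I : Set (ℕ × ℝ≥0∞)} {d : ℕ} (hI : ∀ m ∈ I, m.1 ≤ d) {a : ℕ × ℝ≥0∞}
    (ha : a ∈ I) : monLE a (monSup I) := by
  have hb : BddAbove (Prod.fst '' I) := ⟨d, by rintro _ ⟨m, hm, rfl⟩; exact hI m hm⟩
  have h := le_csSup hb (Set.mem_image_of_mem _ ha)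
  rcases h.lt_or_eq with h | h
  · exact Or.inl h
  · refine Or.inr ⟨h, le_sSup ?_⟩
    rw [Set.mem_ofPred_eq, ← h]
    exact ha

lemma exists_mem_fst_eq_monSup {I : Set (ℕ × ℝ≥0∞)} {d : ℕ} (hI : ∀ m ∈ I, m.1 ≤ d)
    (hne : I.Nonempty) : ∃ a ∈ I, a.1 = (monSup I).1 :=
  Nat.sSup_mem (hne.image _) ⟨d, by rintro _ ⟨m, hm, rfl⟩; exact hI m hm⟩

lemma monSup_monLE {I : Set (ℕ × ℝ≥0∞)} {d : ℕ} (hI : ∀ m ∈ I, m.1 ≤ d) (hne : I.Nonempty)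
    {b : ℕ × ℝ≥0∞} (hb : ∀ a ∈ I, monLE a b) : monLE (monSup I) b := by
  obtain ⟨a, ha, hd⟩ := exists_mem_fst_eq_monSup hI hne
  rcases hb a ha with h | ⟨h, -⟩
  · exact Or.inl (hd ▸ h)
  · refine Or.inr ⟨hd ▸ h, sSup_le fun r hr => ?_⟩
    rcases hb _ hr with h' | ⟨-, h'⟩
    · change (monSup I).1 < b.1 at h'
      omega
    · exact h'

lemma mOplusE_monSup_monLE {I J : Set (ℕ × ℝ≥0∞)} {d : ℕ} (hI : ∀ m ∈ I, m.1 ≤ d)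
    (hJ : ∀ m ∈ J, m.1 ≤ d) (hIne : I.Nonempty) (hJne : J.Nonempty) {b : ℕ × ℝ≥0∞}
    (hb : ∀ a ∈ I, ∀ c ∈ J, monLE (mOplusE a c) b) :
    monLE (mOplusE (monSup I) (monSup J)) b := by
  obtain ⟨a₀, ha₀, hda⟩ := exists_mem_fst_eq_monSup hI hIne
  obtain ⟨c₀, hc₀, hdc⟩ := exists_mem_fst_eq_monSup hJ hJne
  have hIb : monLE (monSup I) b := monSup_monLE hI hIne fun a ha =>
    (monLE_mOplusE_left a c₀).trans (hb a ha c₀ hc₀)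
  have hJb : monLE (monSup J) b := monSup_monLE hJ hJne fun c hc =>
    (monLE_mOplusE_left c a₀).trans (mOplusE_comm c a₀ ▸ hb a₀ ha₀ c hc)
  unfold mOplusE
  split_ifs with h1 h2
  · exact hIb
  · exact hJb
  · have heq : (monSup I).1 = (monSup J).1 := by omega
    rcases hIb with h | ⟨h, -⟩
    · exact Or.inl h
    · refine Or.inr ⟨h, ?_⟩
      change sSup _ + sSup _ ≤ b.2
      rw [sSup_eq_iSup, sSup_eq_iSup]
      refine ENNReal.biSup_add_biSup_le' ⟨a₀.2, ?_⟩ ⟨c₀.2, ?_⟩ fun r hr s hs => ?_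
      · exact (show a₀ = ((monSup I).1, a₀.2) from Prod.ext hda rfl) ▸ ha₀
      · exact (show c₀ = ((monSup J).1, c₀.2) from Prod.ext hdc rfl) ▸ hc₀
      · have := hb _ hr _ hs
        change monLE (mOplusE ((monSup I).1, r) ((monSup J).1, s)) b at this
        unfold mOplusE at this
        rw [if_neg (by simpa using heq.le), if_neg (by simpa using heq.ge)] at this
        rcases this with h' | ⟨-, h'⟩
        · simp only at h'
          omega
        · exact h'

lemma leadMonomial_monLE_of_eventually_le {p q : ℝ[X]} (hp : ∀ᶠ n : ℕ in atTop, 0 ≤ p.eval (n : ℝ))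
    (hpq : ∀ᶠ n : ℕ in atTop, p.eval (n : ℝ) ≤ q.eval (n : ℝ)) :
    monLE (leadMonomial p) (leadMonomial q) := by
  have h : leadMonomial (p + (q - p)) = _ :=
    leadMonomial_add (leadingCoeff_nonneg_of_eventually hp)
      (leadingCoeff_nonneg_of_eventually (q := q - p) (hpq.mono fun n hn => by simpa using hn))
  rw [add_sub_cancel] at h
  rw [h]
  exact monLE_mOplusE_left _ _

end Polynomial

section Step

variable {S ι M N : Type} [CommRing S] [Algebra R S] [AddCommGroup M] [Module R M] [Module S M]
  [IsScalarTower R S M] [AddCommGroup N] [Module R N] [Module S N] [IsScalarTower R S N]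

/-- The sum of the images of `U` under multiplication by the elements `y i`. -/
def stepSubmodule (y : ι → S) (U : Submodule R M) : Submodule R M :=
  ⨆ i, U.map (Algebra.lsmul R R M (y i))

lemma stepSubmodule_le {y : ι → S} {U W : Submodule R M} :
    stepSubmodule y U ≤ W ↔ ∀ i, ∀ u ∈ U, y i • u ∈ W := by
  rw [stepSubmodule, iSup_le_iff]
  exact forall_congr' fun i => Submodule.map_le_iff_le_comap

lemma smul_mem_stepSubmodule (y : ι → S) {U : Submodule R M} (i : ι) {u : M} (hu : u ∈ U) :
    y i • u ∈ stepSubmodule y U :=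
  stepSubmodule_le.1 le_rfl i u hu

lemma stepSubmodule_mono (y : ι → S) : Monotone (stepSubmodule (R := R) (M := M) y) :=
  fun _ _ h => stepSubmodule_le.2 fun i _ hu => smul_mem_stepSubmodule y i (h hu)

lemma map_stepSubmodule (y : ι → S) (f : M →ₗ[S] N) (U : Submodule R M) :
    (stepSubmodule y U).map (f.restrictScalars R)
      = stepSubmodule y (U.map (f.restrictScalars R)) := by
  rw [stepSubmodule, stepSubmodule, Submodule.map_iSup]
  refine iSup_congr fun i => ?_
  rw [← Submodule.map_comp, ← Submodule.map_comp]
  congr 1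
  ext m
  simp

lemma map_iterate_stepSubmodule (y : ι → S) (f : M →ₗ[S] N) (U : Submodule R M) (n : ℕ) :
    ((stepSubmodule y)^[n] U).map (f.restrictScalars R)
      = (stepSubmodule y)^[n] (U.map (f.restrictScalars R)) := by
  induction n with
  | zero => rfl
  | succ n ih => rw [Function.iterate_succ_apply', Function.iterate_succ_apply',
      map_stepSubmodule, ih]

lemma fg_iterate_stepSubmodule [Finite ι] (y : ι → S) {U : Submodule R M} (hU : U.FG) (n : ℕ) :
    ((stepSubmodule y)^[n] U).FG := by
  induction n with
  | zero => exact hU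
  | succ n ih =>
    rw [Function.iterate_succ_apply']
    exact Submodule.fg_iSup _ fun i => ih.map _

/-- The graded family that agrees with `U` up to degree `m` and is generated in degrees at most
`m`. -/
def truncFamily (y : ι → S) (U : ℕ → Submodule R M) (m : ℕ) : ℕ → Submodule R M
  | 0 => U 0
  | n + 1 => if n + 1 ≤ m then U (n + 1) else stepSubmodule y (truncFamily y U m n)

lemma truncFamily_of_le (y : ι → S) (U : ℕ → Submodule R M) {m n : ℕ} (h : n ≤ m) :
    truncFamily y U m n = U n := by
  cases n with
  | zero => rfl
  | succ n => rw [truncFamily, if_pos h]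

lemma truncFamily_le {y : ι → S} {U : ℕ → Submodule R M}
    (hU : ∀ n, stepSubmodule y (U n) ≤ U (n + 1)) (m n : ℕ) : truncFamily y U m n ≤ U n := by
  induction n with
  | zero => exact le_rfl
  | succ n ih =>
    rw [truncFamily]
    split_ifs
    · exact le_rfl
    · exact (stepSubmodule_mono y ih).trans (hU n)

lemma stepSubmodule_truncFamily_le {y : ι → S} {U : ℕ → Submodule R M}
    (hU : ∀ n, stepSubmodule y (U n) ≤ U (n + 1)) (m n : ℕ) :
    stepSubmodule y (truncFamily y U m n) ≤ truncFamily y U m (n + 1) := by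
  rw [truncFamily]
  split_ifs
  · exact (stepSubmodule_mono y (truncFamily_le hU m n)).trans (hU n)
  · exact le_rfl

lemma truncFamily_mono {y : ι → S} {U : ℕ → Submodule R M}
    (hU : ∀ n, stepSubmodule y (U n) ≤ U (n + 1)) {m m' : ℕ} (h : m ≤ m') (n : ℕ) :
    truncFamily y U m n ≤ truncFamily y U m' n := by
  induction n with
  | zero => exact le_rfl
  | succ n ih =>
    by_cases h1 : n + 1 ≤ m'
    · rw [truncFamily_of_le y U h1]
      exact truncFamily_le hU m _
    · rw [truncFamily, if_neg (by omega), truncFamily, if_neg h1]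
      exact stepSubmodule_mono y ih

open MvPolynomial in
/-- The homomorphism onto the Rees algebra of the `y i`, sending `X i` to `y i * t`. -/
noncomputable def reesHom (R : Type) {S ι : Type} [CommRing R] [CommRing S] [Algebra R S]
    (y : ι → S) : MvPolynomial ι R →ₐ[R] Polynomial S :=
  aeval fun i => Polynomial.C (y i) * Polynomial.X

lemma coeff_reesHom_X_mul_succ (y : ι → S) (i : ι) (p : MvPolynomial ι R) (n : ℕ) :
    (reesHom R y (MvPolynomial.X i * p)).coeff (n + 1) = y i * (reesHom R y p).coeff n := by
  rw [map_mul, reesHom, MvPolynomial.aeval_X, mul_assoc, Polynomial.coeff_C_mul,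
    Polynomial.coeff_X_mul]

lemma coeff_reesHom_X_mul_zero (y : ι → S) (i : ι) (p : MvPolynomial ι R) :
    (reesHom R y (MvPolynomial.X i * p)).coeff 0 = 0 := by
  rw [map_mul, reesHom, MvPolynomial.aeval_X, mul_assoc, Polynomial.coeff_C_mul,
    Polynomial.coeff_X_mul_zero, mul_zero]

/-- The degree `n` component of the image in the Rees module of a vector of polynomials. -/
noncomputable def reesComponent (y : ι → S) {r : ℕ} (v : Fin r → M) (n : ℕ) :
    (Fin r → MvPolynomial ι R) →ₗ[R] M :=
  ∑ j, (LinearMap.toSpanSingleton S M (v j)).restrictScalars R ∘ₗ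
    (Polynomial.lcoeff S n).restrictScalars R ∘ₗ (reesHom R y).toLinearMap ∘ₗ LinearMap.proj j

lemma reesComponent_apply (y : ι → S) {r : ℕ} (v : Fin r → M) (n : ℕ)
    (p : Fin r → MvPolynomial ι R) :
    reesComponent y v n p = ∑ j, (reesHom R y (p j)).coeff n • v j := by
  simp [reesComponent]

lemma reesComponent_X_smul_succ (y : ι → S) {r : ℕ} (v : Fin r → M) (n : ℕ) (i : ι)
    (p : Fin r → MvPolynomial ι R) :
    reesComponent y v (n + 1) (MvPolynomial.X (R := R) i • p) = y i • reesComponent y v n p := by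
  simp only [reesComponent_apply, Pi.smul_apply, smul_eq_mul, coeff_reesHom_X_mul_succ, Finset.smul_sum,
    mul_smul]

lemma reesComponent_X_smul_zero (y : ι → S) {r : ℕ} (v : Fin r → M) (i : ι)
    (p : Fin r → MvPolynomial ι R) :
    reesComponent y v 0 (MvPolynomial.X (R := R) i • p) = 0 := by
  simp only [reesComponent_apply, Pi.smul_apply, smul_eq_mul, coeff_reesHom_X_mul_zero, zero_smul,
    Finset.sum_const_zero]

/-- The vectors of polynomials whose components all lie in the graded family `U`. -/
def reesSubmodule (y : ι → S) {r : ℕ} (v : Fin r → M) (U : ℕ → Submodule R M)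
    (hU : ∀ n, stepSubmodule y (U n) ≤ U (n + 1)) :
    Submodule (MvPolynomial ι R) (Fin r → MvPolynomial ι R) where
  carrier := {p | ∀ n, reesComponent y v n p ∈ U n}
  add_mem' hp hq n := by
    rw [map_add]
    exact add_mem (hp n) (hq n)
  zero_mem' n := by
    rw [map_zero]
    exact zero_mem _
  smul_mem' a p hp := by
    induction a using MvPolynomial.induction_on with
    | C a =>
      intro n
      rw [← MvPolynomial.algebraMap_eq, algebraMap_smul, map_smul]
      exact Submodule.smul_mem _ _ (hp n)
    | add a b ha hb =>
      intro n
      rw [add_smul, map_add]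
      exact add_mem (ha n) (hb n)
    | mul_X a i ha =>
      rw [mul_comm, mul_smul]
      rintro (_ | n)
      · rw [reesComponent_X_smul_zero]
        exact zero_mem _
      · rw [reesComponent_X_smul_succ]
        exact hU n (smul_mem_stepSubmodule y i (ha n))

lemma exists_reesComponent_eq (y : ι → S) {r : ℕ} (v : Fin r → M) (n : ℕ) {m : M}
    (hm : m ∈ (stepSubmodule y)^[n] (Submodule.span R (Set.range v))) :
    ∃ p : Fin r → MvPolynomial ι R, ∀ i, reesComponent y v i p = if i = n then m else 0 := by
  induction n generalizing m with
  | zero =>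
    obtain ⟨c, rfl⟩ := (Submodule.mem_span_range_iff_exists_fun R).1 hm
    refine ⟨fun j => MvPolynomial.C (c j), fun i => ?_⟩
    have h (j : Fin r) :
        reesHom R y (MvPolynomial.C (c j)) = Polynomial.C (algebraMap R S (c j)) := by
      rw [reesHom, MvPolynomial.aeval_C]
      rfl
    simp only [reesComponent_apply, h, Polynomial.coeff_C]
    split_ifs <;> simp
  | succ n ih =>
    rw [Function.iterate_succ_apply', stepSubmodule] at hm
    induction hm using Submodule.iSup_induction' with
    | mem i x hx =>
      obtain ⟨u, hu, rfl⟩ := hx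
      obtain ⟨p, hp⟩ := ih hu
      refine ⟨MvPolynomial.X (R := R) i • p, ?_⟩
      rintro (_ | l)
      · rw [reesComponent_X_smul_zero]
        simp
      · rw [reesComponent_X_smul_succ, hp]
        split_ifs <;> simp_all
    | zero => exact ⟨0, fun i => by rw [map_zero, ite_self]⟩
    | add x x' _ _ hx hx' =>
      obtain ⟨p, hp⟩ := hx
      obtain ⟨q, hq⟩ := hx'
      refine ⟨p + q, fun i => ?_⟩
      rw [map_add, hp, hq]
      split_ifs <;> simp

lemma le_of_reesSubmodule_le {y : ι → S} {r : ℕ} {v : Fin r → M} {U W : ℕ → Submodule R M}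
    {hU : ∀ n, stepSubmodule y (U n) ≤ U (n + 1)} {hW : ∀ n, stepSubmodule y (W n) ≤ W (n + 1)}
    (hUv : ∀ n, U n ≤ (stepSubmodule y)^[n] (Submodule.span R (Set.range v)))
    (h : reesSubmodule y v U hU ≤ reesSubmodule y v W hW) (n : ℕ) : U n ≤ W n := by
  intro m hm
  obtain ⟨p, hp⟩ := exists_reesComponent_eq y v n (hUv n hm)
  have hpU : p ∈ reesSubmodule y v U hU := fun i => by
    rw [hp]
    split_ifs with hi
    · exact hi ▸ hm
    · exact zero_mem _
  have := h hpU n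
  rwa [hp, if_pos rfl] at this

/-- Artin–Rees: a graded subfamily of the family generated by a finitely generated module is
itself generated in bounded degree. -/
lemma exists_forall_eq_stepSubmodule [IsNoetherianRing R] [Finite ι] (y : ι → S)
    {V : Submodule R M} (hV : V.FG) {U : ℕ → Submodule R M}
    (hU : ∀ n, stepSubmodule y (U n) ≤ U (n + 1)) (hUV : ∀ n, U n ≤ (stepSubmodule y)^[n] V) :
    ∃ n₀, ∀ n, n₀ ≤ n → U (n + 1) = stepSubmodule y (U n) := by
  obtain ⟨r, v, rfl⟩ := Submodule.fg_iff_exists_fin_generating_family.1 hV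
  obtain ⟨n₀, h₀⟩ := monotone_stabilizes_iff_noetherian.2
    (inferInstance : IsNoetherian (MvPolynomial ι R) (Fin r → MvPolynomial ι R))
    ⟨fun m => reesSubmodule y v (truncFamily y U m) (stepSubmodule_truncFamily_le hU m),
      fun m m' h p hp n => truncFamily_mono hU h n (hp n)⟩
  have key (m : ℕ) (hm : n₀ ≤ m) (n : ℕ) : truncFamily y U m n = truncFamily y U n₀ n :=
    le_antisymm
      (le_of_reesSubmodule_le (hU := stepSubmodule_truncFamily_le hU m)
        (hW := stepSubmodule_truncFamily_le hU n₀)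
        (fun n => (truncFamily_le hU m n).trans (hUV n)) (h₀ m hm).ge n)
      (truncFamily_mono hU hm n)
  refine ⟨n₀, fun n hn => ?_⟩
  rw [← truncFamily_of_le y U (le_refl (n + 1)), key (n + 1) (by omega), truncFamily,
    if_neg (by omega), ← key n hn, truncFamily_of_le y U le_rfl]

end Step

section Length

variable (L : LengthFunction R) {M N : Type} [AddCommGroup M] [Module R M] [AddCommGroup N]
  [Module R N]

namespace LengthFunction

lemma l_eq_ker_add_range (f : M →ₗ[R] N) :
    L.l M = L.l (LinearMap.ker f) + L.l (LinearMap.range f) := by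
  rw [L.l_add M (LinearMap.ker f), L.l_congr _ _ f.quotKerEquivRange]

lemma l_eq_inf_ker_add_map (f : M →ₗ[R] N) (U : Submodule R M) :
    L.l U = L.l (U ⊓ LinearMap.ker f : Submodule R M) + L.l (U.map f) := by
  rw [L.l_eq_ker_add_range (f.domRestrict U), LinearMap.range_domRestrict]
  congr 1
  refine L.l_congr _ _ ((Submodule.equivMapOfInjective U.subtype U.injective_subtype _).trans
    (LinearEquiv.ofEq _ _ ?_))
  ext m
  simp [and_comm]

lemma l_mono {U W : Submodule R M} (h : U ≤ W) : L.l U ≤ L.l W := by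
  rw [L.l_eq_inf_ker_add_map U.mkQ W, Submodule.ker_mkQ, inf_eq_right.2 h]
  exact le_self_add

lemma l_map_of_injective {f : M →ₗ[R] N} (hf : Function.Injective f) (U : Submodule R M) :
    L.l (U.map f) = L.l U :=
  (L.l_congr _ _ (Submodule.equivMapOfInjective f hf U)).symm

lemma l_map_le (f : M →ₗ[R] N) (U : Submodule R M) : L.l (U.map f) ≤ L.l U := by
  rw [L.l_eq_inf_ker_add_map f U]
  exact le_add_self

lemma l_add_l_eq (f : M →ₗ[R] N) (U : Submodule R M) (W : Submodule R N) :
    L.l U + L.l W = L.l (U ⊓ W.comap f : Submodule R M) + L.l (U.map f ⊔ W : Submodule R N) := by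
  have h1 := L.l_eq_inf_ker_add_map (W.mkQ.comp f) U
  have h2 := L.l_eq_inf_ker_add_map W.mkQ (U.map f ⊔ W)
  rw [LinearMap.ker_comp, Submodule.ker_mkQ, Submodule.map_comp] at h1
  rw [Submodule.ker_mkQ, inf_eq_right.2 le_sup_right, Submodule.map_sup,
    Submodule.mkQ_map_self, sup_bot_eq] at h2
  rw [h1, h2]
  ring

end LengthFunction

end Length

section Hilbert

variable (L : LengthFunction R) {S ι M : Type} [CommRing S] [Algebra R S] [AddCommGroup M]
  [Module R M] [Module S M] [IsScalarTower R S M]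

/-- The family `y a • U (n - 1) + W n`, generated by `W` and the multiples of `U` by `y a`. -/
def smulSupFamily (y : ι → S) (a : ι) (U W : ℕ → Submodule R M) : ℕ → Submodule R M
  | 0 => W 0
  | n + 1 => (U n).map (Algebra.lsmul R R M (y a)) ⊔ W (n + 1)

lemma le_smulSupFamily (y : ι → S) (a : ι) (U W : ℕ → Submodule R M) (n : ℕ) :
    W n ≤ smulSupFamily y a U W n := by
  cases n
  · exact le_rfl
  · exact le_sup_right

lemma stepSubmodule_smulSupFamily_le {y : ι → S} (a : ι) {U W : ℕ → Submodule R M}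
    (hU : ∀ n, stepSubmodule y (U n) ≤ U (n + 1)) (hW : ∀ n, stepSubmodule y (W n) ≤ W (n + 1))
    (n : ℕ) : stepSubmodule y (smulSupFamily y a U W n) ≤ smulSupFamily y a U W (n + 1) := by
  cases n with
  | zero => exact (hW 0).trans (le_smulSupFamily y a U W 1)
  | succ n =>
    refine stepSubmodule_le.2 fun i m hm => ?_
    obtain ⟨_, ⟨u, hu, rfl⟩, w, hw, rfl⟩ := Submodule.mem_sup.1 hm
    rw [smul_add]
    refine add_mem (Submodule.mem_sup_left ⟨y i • u, hU n (smul_mem_stepSubmodule y i hu), ?_⟩)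
      (Submodule.mem_sup_right (hW _ (smul_mem_stepSubmodule y i hw)))
    simp [smul_comm (y a) (y i)]

/-- The Hilbert–Serre theorem for a quotient `U / W` of graded families, annihilated by `y i` for
`i ∉ T`. -/
lemma eventuallyPoly_sub [IsNoetherianRing R] [Finite ι] (y : ι → S) {V : Submodule R M}
    (hV : V.FG) (hfin : ∀ n, L.l ((stepSubmodule y)^[n] V) < ⊤) (T : Finset ι)
    {U W : ℕ → Submodule R M} (hU : ∀ n, stepSubmodule y (U n) ≤ U (n + 1))
    (hW : ∀ n, stepSubmodule y (W n) ≤ W (n + 1)) (hWU : ∀ n, W n ≤ U n)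
    (hUV : ∀ n, U n ≤ (stepSubmodule y)^[n] V)
    (hT : ∀ i ∉ T, ∀ n, ∀ u ∈ U n, y i • u ∈ W (n + 1)) :
    EventuallyPoly T.card (fun n => (L.l (U n)).toReal - (L.l (W n)).toReal) := by
  classical
  induction T using Finset.induction_on generalizing U W with
  | empty =>
    obtain ⟨n₀, h₀⟩ := exists_forall_eq_stepSubmodule y hV hU hUV
    refine ⟨0, Submodule.zero_mem _, eventually_atTop.2 ⟨n₀ + 1, fun n hn => ?_⟩⟩
    obtain ⟨n, rfl⟩ := Nat.exists_eq_add_of_le' (Nat.le_of_add_left_le hn)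
    have h : U (n + 1) ≤ W (n + 1) := by
      rw [h₀ n (by omega), stepSubmodule_le]
      exact fun i => hT i (Finset.notMem_empty i) n
    dsimp only
    rw [le_antisymm h (hWU _), sub_self, Polynomial.eval_zero]
  | insert a T haT ih =>
    rw [Finset.card_insert_of_notMem haT]
    set X := smulSupFamily y a U W
    set K : ℕ → Submodule R M :=
      fun n => U n ⊓ (W (n + 1)).comap (Algebra.lsmul R R M (y a))
    have hXU (n : ℕ) : X n ≤ U n := by
      cases n with
      | zero => exact hWU 0
      | succ n =>
        refine sup_le ?_ (hWU _)
        rintro _ ⟨u, hu, rfl⟩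
        exact hU n (smul_mem_stepSubmodule y a hu)
    have hKstep (n : ℕ) : stepSubmodule y (K n) ≤ K (n + 1) := by
      refine stepSubmodule_le.2 fun i m hm => ⟨hU n (smul_mem_stepSubmodule y i hm.1), ?_⟩
      have h := hW _ (smul_mem_stepSubmodule y i hm.2)
      simpa [smul_comm (y i) (y a)] using h
    have hWK (n : ℕ) : W n ≤ K n :=
      fun w hw => ⟨hWU n hw, hW n (smul_mem_stepSubmodule y a hw)⟩
    have h1 := ih hU (stepSubmodule_smulSupFamily_le a hU hW) hXU hUV fun i hi n u hu => by
      by_cases hia : i = a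
      · exact Submodule.mem_sup_left ⟨u, hu, by rw [hia]; rfl⟩
      · exact Submodule.mem_sup_right (hT i (by simp [hi, hia]) n u hu)
    have h2 := ih hKstep hW hWK (fun n => inf_le_left.trans (hUV n)) fun i hi n u hu => by
      by_cases hia : i = a
      · exact hia ▸ hu.2
      · exact hT i (by simp [hi, hia]) n u hu.1
    refine EventuallyPoly.of_forward_sub ?_
    convert h1.shift.sub h2 using 2 with n
    have h := L.l_add_l_eq (Algebra.lsmul R R M (y a)) (U n) (W (n + 1))
    change L.l (U n) + L.l (W (n + 1)) = L.l (K n) + L.l (X (n + 1)) at h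
    have hf {n : ℕ} {P : Submodule R M} (hP : P ≤ U n) : L.l P ≠ ⊤ :=
      ((L.l_mono (hP.trans (hUV n))).trans_lt (hfin n)).ne
    have h' := congrArg ENNReal.toReal h
    rw [ENNReal.toReal_add (hf le_rfl) (hf (hWU _)),
      ENNReal.toReal_add (hf (n := n) inf_le_left) (hf (hXU _))] at h'
    linarith

lemma eventuallyPoly_iterate_stepSubmodule [IsNoetherianRing R] [Fintype ι] (y : ι → S)
    {V : Submodule R M} (hV : V.FG) (hfin : ∀ n, L.l ((stepSubmodule y)^[n] V) < ⊤) :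
    EventuallyPoly (Fintype.card ι) (fun n => (L.l ((stepSubmodule y)^[n] V)).toReal) := by
  have h := eventuallyPoly_sub L y hV hfin Finset.univ
    (U := fun n => (stepSubmodule y)^[n] V) (W := fun _ => ⊥)
    (fun n => (Function.iterate_succ_apply' _ n V).ge)
    (fun n => by rw [stepSubmodule_le]; simp) (fun _ => bot_le) (fun _ => le_rfl) (by simp)
  simpa [L.l_zero (⊥ : Submodule R M) inferInstance] using h

end Hilbert

section Small

open MvPolynomial

variable {k : ℕ} {M : Type} [AddCommGroup M] [Module R M] [Module (MvPolynomial (Fin k) R) M]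
  [IsScalarTower R (MvPolynomial (Fin k) R) M]

/-- The variables of `MvPolynomial (Fin k) R` together with `1`. -/
noncomputable def filtrationVar (R : Type) [CommRing R] (k : ℕ) :
    Option (Fin k) → MvPolynomial (Fin k) R :=
  fun o => o.elim 1 X

lemma le_stepSubmodule_filtrationVar (V : Submodule R M) :
    V ≤ stepSubmodule (filtrationVar R k) V := fun v hv => by
  simpa [filtrationVar] using smul_mem_stepSubmodule (filtrationVar R k) none hv

lemma X_smul_mem_stepSubmodule (V : Submodule R M) (i : Fin k) {v : M} (hv : v ∈ V) :
    (X i : MvPolynomial (Fin k) R) • v ∈ stepSubmodule (filtrationVar R k) V :=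
  smul_mem_stepSubmodule (filtrationVar R k) (some i) hv

lemma iterate_stepSubmodule_filtrationVar_mono (V : Submodule R M) :
    Monotone fun n => (stepSubmodule (filtrationVar R k))^[n] V :=
  monotone_nat_of_le_succ fun n => by
    rw [Function.iterate_succ_apply']
    exact le_stepSubmodule_filtrationVar _

lemma monomial_smul_mem (V : Submodule R M) {v : M} (hv : v ∈ V) (s : Fin k →₀ ℕ) (a : R) :
    monomial s a • v ∈ (stepSubmodule (filtrationVar R k))^[s.degree] V := by
  induction s using Finsupp.induction_linear generalizing a V v with
  | zero =>
    rw [map_zero, ← C_apply, ← algebraMap_eq, algebraMap_smul]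
    exact V.smul_mem a hv
  | add s t hs ht =>
    rw [map_add, Function.iterate_add_apply, ← one_mul a, ← monomial_mul, mul_smul]
    exact hs _ (ht V hv a) 1
  | single i n =>
    rw [Finsupp.degree_single]
    induction n with
    | zero =>
      rw [Finsupp.single_zero, ← C_apply, ← algebraMap_eq, algebraMap_smul]
      exact V.smul_mem a hv
    | succ n ih =>
      rw [Finsupp.single_add, monomial_add_single, pow_one, mul_comm, mul_smul,
        Function.iterate_succ_apply']
      exact X_smul_mem_stepSubmodule _ i ih

lemma degSmul_eq_iterate (V : Submodule R M) (n : ℕ) :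
    degSmul k n V = (stepSubmodule (filtrationVar R k))^[n] V := by
  apply le_antisymm
  · refine Submodule.span_le.2 ?_
    rintro _ ⟨p, hp, v, hv, rfl⟩
    rw [mem_restrictTotalDegree] at hp
    rw [p.as_sum, Finset.sum_smul]
    refine Submodule.sum_mem _ fun s hs => ?_
    exact iterate_stepSubmodule_filtrationVar_mono V ((le_totalDegree hs).trans hp)
      (monomial_smul_mem V hv s _)
  · induction n with
    | zero =>
      exact fun v hv =>
        Submodule.subset_span ⟨1, by simp [mem_restrictTotalDegree], v, hv, one_smul _ _⟩
    | succ n ih =>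
      rw [Function.iterate_succ_apply']
      refine (stepSubmodule_mono _ ih).trans (stepSubmodule_le.2 fun i u hu => ?_)
      induction hu using Submodule.span_induction with
      | mem u hu =>
        obtain ⟨p, hp, v, hv, rfl⟩ := hu
        refine Submodule.subset_span ⟨filtrationVar R k i * p, ?_, v, hv, mul_smul _ _ _⟩
        rw [mem_restrictTotalDegree] at hp ⊢
        refine (totalDegree_mul _ _).trans ?_
        have : (filtrationVar R k i).totalDegree ≤ 1 := by
          cases i with
          | none => simp [filtrationVar]
          | some i => exact (totalDegree_monomial_le _ _).trans (by simp)
        omega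
      | zero => simp
      | add u w _ _ hu hw =>
        rw [smul_add]
        exact add_mem hu hw
      | smul r u _ hu =>
        rw [smul_comm]
        exact Submodule.smul_mem _ _ hu

lemma exists_mem_iterate_stepSubmodule {V : Submodule R M}
    (hV : Submodule.span (MvPolynomial (Fin k) R) (V : Set M) = ⊤) (m : M) :
    ∃ n, m ∈ (stepSubmodule (filtrationVar R k))^[n] V := by
  have hm : m ∈ Submodule.span (MvPolynomial (Fin k) R) (V : Set M) := hV ▸ Submodule.mem_top
  induction hm using Submodule.span_induction with
  | mem m hm => exact ⟨0, hm⟩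
  | zero => exact ⟨0, zero_mem _⟩
  | add u w _ _ hu hw =>
    obtain ⟨a, ha⟩ := hu
    obtain ⟨b, hb⟩ := hw
    exact ⟨max a b, add_mem
      (iterate_stepSubmodule_filtrationVar_mono V (le_max_left a b) ha)
      (iterate_stepSubmodule_filtrationVar_mono V (le_max_right a b) hb)⟩
  | smul p u _ hu =>
    obtain ⟨a, ha⟩ := hu
    refine ⟨p.totalDegree + a, ?_⟩
    rw [Function.iterate_add_apply, ← degSmul_eq_iterate]
    exact Submodule.subset_span ⟨p, (mem_restrictTotalDegree _ _ _).2 le_rfl, u, ha, rfl⟩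

lemma exists_le_iterate_stepSubmodule {V W : Submodule R M} (hV : V.FG)
    (hW : Submodule.span (MvPolynomial (Fin k) R) (W : Set M) = ⊤) :
    ∃ n, V ≤ (stepSubmodule (filtrationVar R k))^[n] W := by
  obtain ⟨s, rfl⟩ := hV
  choose a ha using exists_mem_iterate_stepSubmodule hW
  exact ⟨s.sup a, Submodule.span_le.2 fun m hm =>
    iterate_stepSubmodule_filtrationVar_mono W (Finset.le_sup hm) (ha m)⟩

lemma iterate_stepSubmodule_le_span (V : Submodule R M) (n : ℕ) :
    ((stepSubmodule (filtrationVar R k))^[n] V : Set M)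
      ⊆ Submodule.span (MvPolynomial (Fin k) R) (V : Set M) := by
  rw [← degSmul_eq_iterate]
  change degSmul k n V ≤ (Submodule.span (MvPolynomial (Fin k) R) (V : Set M)).restrictScalars R
  refine Submodule.span_le.2 ?_
  rintro _ ⟨p, -, v, hv, rfl⟩
  exact Submodule.smul_mem _ p (Submodule.subset_span hv)

lemma exists_fg_span_eq_top [Module.Finite (MvPolynomial (Fin k) R) M] :
    ∃ V : Submodule R M, V.FG ∧ Submodule.span (MvPolynomial (Fin k) R) (V : Set M) = ⊤ := by
  obtain ⟨s, hs⟩ := Module.Finite.fg_top (R := MvPolynomial (Fin k) R) (M := M)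
  exact ⟨Submodule.span R s, ⟨s, rfl⟩, by rw [Submodule.span_span_of_tower, hs]⟩

variable {L : LengthFunction R}

/-- `q` is the Hilbert polynomial of `M` with respect to some finitely generated `V` that
generates `M` over the polynomial ring. -/
def IsHilbertPoly (k : ℕ) (L : LengthFunction R) (M : Type) [AddCommGroup M] [Module R M]
    [Module (MvPolynomial (Fin k) R) M] [IsScalarTower R (MvPolynomial (Fin k) R) M]
    (V : Submodule R M) (q : Polynomial ℝ) : Prop :=
  V.FG ∧ Submodule.span (MvPolynomial (Fin k) R) (V : Set M) = ⊤ ∧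
    ∀ᶠ n : ℕ in atTop, (L.l ((stepSubmodule (filtrationVar R k))^[n] V : Submodule R M)).toReal
      = q.eval (n : ℝ)

lemma exists_isHilbertPoly [IsNoetherianRing R] (hM : ∀ V : Submodule R M, V.FG → L.l V < ⊤)
    {V : Submodule R M} (hV : V.FG)
    (hspan : Submodule.span (MvPolynomial (Fin k) R) (V : Set M) = ⊤) :
    ∃ q ∈ Polynomial.degreeLT ℝ (k + 1), IsHilbertPoly k L M V q := by
  obtain ⟨q, hq, h⟩ := eventuallyPoly_iterate_stepSubmodule L (filtrationVar R k) hV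
    fun n => hM _ (fg_iterate_stepSubmodule _ hV n)
  exact ⟨q, by simpa using hq, hV, hspan, h⟩

lemma IsHilbertPoly.leadingCoeff_nonneg {V : Submodule R M} {q : Polynomial ℝ}
    (h : IsHilbertPoly k L M V q) : 0 ≤ q.leadingCoeff :=
  leadingCoeff_nonneg_of_eventually (h.2.2.mono fun _ hn => hn ▸ ENNReal.toReal_nonneg)

lemma IsHilbertPoly.leadMonomial_monLE (hM : ∀ V : Submodule R M, V.FG → L.l V < ⊤)
    {V W : Submodule R M} {p q : Polynomial ℝ} (hp : IsHilbertPoly k L M V p)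
    (hq : IsHilbertPoly k L M W q) : monLE (leadMonomial p) (leadMonomial q) := by
  obtain ⟨a, ha⟩ := exists_le_iterate_stepSubmodule hp.1 hq.2.1
  rw [← leadMonomial_comp_X_add_C q a]
  refine leadMonomial_monLE_of_eventually_le (hp.2.2.mono fun _ hn => hn ▸ ENNReal.toReal_nonneg) ?_
  filter_upwards [hp.2.2, (tendsto_add_atTop_nat a).eventually hq.2.2] with n h1 h2
  have e : (q.comp (Polynomial.X + Polynomial.C (a : ℝ))).eval (n : ℝ)
      = q.eval ((n + a : ℕ) : ℝ) := by simp
  rw [e, ← h1, ← h2, Function.iterate_add_apply]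
  refine ENNReal.toReal_mono (hM _ ?_).ne (L.l_mono ((stepSubmodule_mono _).iterate n ha))
  exact fg_iterate_stepSubmodule _ (fg_iterate_stepSubmodule _ hq.1 a) n

lemma IsHilbertPoly.muSmall_eq (hM : ∀ V : Submodule R M, V.FG → L.l V < ⊤)
    {V : Submodule R M} {q : Polynomial ℝ} (hq : IsHilbertPoly k L M V q) :
    muSmall k L M = leadMonomial q := by
  have h : ∃ (V : Submodule R M) (q : Polynomial ℝ),
      V.FG ∧ L.l V < ⊤ ∧ Submodule.span (MvPolynomial (Fin k) R) (V : Set M) = ⊤ ∧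
        (∀ᶠ n : ℕ in atTop, (L.l (degSmul k n V)).toReal = q.eval (n : ℝ)) :=
    ⟨V, q, hq.1, hM V hq.1, hq.2.1, hq.2.2.mono fun n hn => by rwa [degSmul_eq_iterate]⟩
  have hc : IsHilbertPoly k L M h.choose h.choose_spec.choose := by
    obtain ⟨h1, -, h3, h4⟩ := h.choose_spec.choose_spec
    exact ⟨h1, h3, h4.mono fun n hn => by rwa [← degSmul_eq_iterate]⟩
  have e : muSmall k L M = leadMonomial h.choose_spec.choose := by
    rw [muSmall, dif_pos h]
    rfl
  rw [e]
  exact (hc.leadMonomial_monLE hM hq).antisymm (hq.leadMonomial_monLE hM hc)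

lemma IsSmall.muSmall_fst_le [IsNoetherianRing R] (hM : IsSmall k L M) :
    (muSmall k L M).1 ≤ k := by
  have := hM.1
  obtain ⟨V, hV, hspan⟩ := exists_fg_span_eq_top (R := R) (k := k) (M := M)
  obtain ⟨q, hd, hq⟩ := exists_isHilbertPoly hM.2 hV hspan
  rw [hq.muSmall_eq hM.2]
  refine Polynomial.natDegree_le_iff_coeff_eq_zero.2 fun i hi =>
    Polynomial.coeff_eq_zero_of_degree_lt ((Polynomial.mem_degreeLT.1 hd).trans_le ?_)
  exact_mod_cast hi

section Exact

variable {A B C : Type} [AddCommGroup A] [Module R A] [Module (MvPolynomial (Fin k) R) A]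
  [IsScalarTower R (MvPolynomial (Fin k) R) A] [AddCommGroup B] [Module R B]
  [Module (MvPolynomial (Fin k) R) B] [IsScalarTower R (MvPolynomial (Fin k) R) B]
  [AddCommGroup C] [Module R C] [Module (MvPolynomial (Fin k) R) C]
  [IsScalarTower R (MvPolynomial (Fin k) R) C]

lemma locallyFinite_of_injective {f : A →ₗ[MvPolynomial (Fin k) R] B}
    (hf : Function.Injective f) (hB : ∀ V : Submodule R B, V.FG → L.l V < ⊤)
    (V : Submodule R A) (hV : V.FG) : L.l V < ⊤ := by
  rw [← L.l_map_of_injective (f := f.restrictScalars R) hf V]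
  exact hB _ (hV.map _)

/-- Every finitely generated submodule lifts along a surjection. -/
lemma exists_fg_map_eq {T P Q : Type} [Ring T] [AddCommGroup P] [Module T P] [AddCommGroup Q]
    [Module T Q] {g : P →ₗ[T] Q} (hg : Function.Surjective g) {V : Submodule T Q} (hV : V.FG) :
    ∃ W : Submodule T P, W.FG ∧ W.map g = V := by
  obtain ⟨s, rfl⟩ := hV
  refine ⟨Submodule.span T (Function.surjInv hg '' s),
    Submodule.fg_span (s.finite_toSet.image _), ?_⟩
  rw [Submodule.map_span, ← Set.image_comp]
  congr 1
  ext c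
  simp [Function.surjInv_eq hg]

lemma locallyFinite_of_surjective {g : B →ₗ[MvPolynomial (Fin k) R] C}
    (hg : Function.Surjective g) (hB : ∀ V : Submodule R B, V.FG → L.l V < ⊤)
    (V : Submodule R C) (hV : V.FG) : L.l V < ⊤ := by
  obtain ⟨W, hW, rfl⟩ := exists_fg_map_eq (g := g.restrictScalars R) hg hV
  exact (L.l_map_le _ W).trans_lt (hB W hW)

/-- Additivity of the leading monomial on short exact sequences of small modules. -/
lemma muSmall_eq_mOplusE [IsNoetherianRing R] {f : A →ₗ[MvPolynomial (Fin k) R] B}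
    {g : B →ₗ[MvPolynomial (Fin k) R] C} (hf : Function.Injective f) (hg : Function.Surjective g)
    (hfg : LinearMap.range f = LinearMap.ker g) (hB : IsSmall k L B) :
    muSmall k L B = mOplusE (muSmall k L A) (muSmall k L C) := by
  have := hB.1
  set y := filtrationVar R k
  set f' := f.restrictScalars R
  set g' := g.restrictScalars R
  have hA := locallyFinite_of_injective hf hB.2
  have hC := locallyFinite_of_surjective hg hB.2
  obtain ⟨V, hV, hspan⟩ := exists_fg_span_eq_top (R := R) (k := k) (M := B)
  obtain ⟨q, -, hq⟩ := exists_isHilbertPoly hB.2 hV hspan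
  set U : ℕ → Submodule R B := fun n => (stepSubmodule y)^[n] V ⊓ LinearMap.ker g'
  have hUstep (n : ℕ) : stepSubmodule y (U n) ≤ U (n + 1) := by
    refine stepSubmodule_le.2 fun i u hu => ⟨?_, ?_⟩
    · rw [Function.iterate_succ_apply']
      exact smul_mem_stepSubmodule y i hu.1
    · have h : g u = 0 := hu.2
      change g (y i • u) = 0
      rw [map_smul, h, smul_zero]
  obtain ⟨n₀, h₀⟩ := exists_forall_eq_stepSubmodule y hV hUstep fun n => inf_le_left
  have hUn (n : ℕ) : U (n + n₀) = (stepSubmodule y)^[n] (U n₀) := by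
    induction n with
    | zero => rw [Nat.zero_add]; rfl
    | succ n ih => rw [Nat.add_right_comm, h₀ _ (by omega), ih, Function.iterate_succ_apply']
  have hrange {b : B} (hb : g b = 0) : ∃ a, f a = b := by
    have : b ∈ LinearMap.range f := hfg ▸ LinearMap.mem_ker.2 hb
    exact this
  set VA := (U n₀).comap f'
  have hmapVA : VA.map f' = U n₀ :=
    Submodule.map_comap_eq_self fun b hb => hrange hb.2
  have hlA (n : ℕ) : L.l ((stepSubmodule y)^[n] VA : Submodule R A) = L.l (U (n + n₀)) := by
    rw [← L.l_map_of_injective (f := f') hf, map_iterate_stepSubmodule, hmapVA, hUn]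
  have hVAfg : VA.FG := by
    refine Submodule.fg_of_fg_map_injective f' hf ?_
    rw [hmapVA]
    exact Submodule.FG.of_le (fg_iterate_stepSubmodule y hV n₀) inf_le_left
  have hVAspan : Submodule.span (MvPolynomial (Fin k) R) (VA : Set A) = ⊤ := by
    refine eq_top_iff.2 fun a _ => ?_
    obtain ⟨n, hn⟩ := exists_mem_iterate_stepSubmodule hspan (f a)
    have hker : g (f a) = 0 := by
      have : f a ∈ LinearMap.ker g := hfg ▸ LinearMap.mem_range_self f a
      exact this
    have h : f a ∈ U (n + n₀) :=
      ⟨iterate_stepSubmodule_filtrationVar_mono V (Nat.le_add_right n n₀) hn, hker⟩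
    rw [hUn, ← hmapVA, ← map_iterate_stepSubmodule] at h
    obtain ⟨a', ha', h⟩ := h
    rw [← hf h]
    exact iterate_stepSubmodule_le_span VA n ha'
  have hVCspan : Submodule.span (MvPolynomial (Fin k) R) (V.map g' : Set C) = ⊤ := by
    have h : ((V.map g' : Submodule R C) : Set C) = g '' V := rfl
    rw [h, ← Submodule.map_span, hspan, Submodule.map_top, LinearMap.range_eq_top.2 hg]
  obtain ⟨qA, -, hqA⟩ := exists_isHilbertPoly hA hVAfg hVAspan
  obtain ⟨qC, -, hqC⟩ := exists_isHilbertPoly hC (hV.map g') hVCspan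
  have key : q.comp (Polynomial.X + Polynomial.C (n₀ : ℝ))
      = qA + qC.comp (Polynomial.X + Polynomial.C (n₀ : ℝ)) := by
    refine Polynomial.eq_of_infinite_eval_eq _ _ (Set.Infinite.mono ?_
      (Nat.frequently_atTop_iff_infinite.1 (Eventually.frequently
        (hqA.2.2.and ((tendsto_add_atTop_nat n₀).eventually (hq.2.2.and hqC.2.2)))) |>.image
          (Nat.cast_injective (R := ℝ)).injOn))
    rintro _ ⟨n, ⟨h1, h2, h3⟩, rfl⟩
    have e (p : Polynomial ℝ) : (p.comp (Polynomial.X + Polynomial.C (n₀ : ℝ))).eval (n : ℝ)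
        = p.eval ((n + n₀ : ℕ) : ℝ) := by simp
    have hl := L.l_eq_inf_ker_add_map g' ((stepSubmodule y)^[n + n₀] V)
    rw [map_iterate_stepSubmodule, ← hlA] at hl
    change Polynomial.eval _ _ = Polynomial.eval _ _
    rw [Polynomial.eval_add, e, e, ← h1, ← h2, ← h3, hl, ENNReal.toReal_add]
    · exact (hA _ (fg_iterate_stepSubmodule y hVAfg n)).ne
    · exact (hC _ (fg_iterate_stepSubmodule y (hV.map g') (n + n₀))).ne
  rw [hq.muSmall_eq hB.2, hqA.muSmall_eq hA, hqC.muSmall_eq hC,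
    ← leadMonomial_comp_X_add_C q n₀, ← leadMonomial_comp_X_add_C qC n₀, key]
  refine leadMonomial_add hqA.leadingCoeff_nonneg ?_
  rw [Polynomial.leadingCoeff_comp (by rw [Polynomial.natDegree_X_add_C]; exact one_ne_zero),
    Polynomial.leadingCoeff_X_add_C, one_pow, mul_one]
  exact hqC.leadingCoeff_nonneg

end Exact

lemma isSmall_of_fg (hM : ∀ V : Submodule R M, V.FG → L.l V < ⊤)
    {M' : Submodule (MvPolynomial (Fin k) R) M} (h : M'.FG) : IsSmall k L M' :=
  ⟨Module.Finite.iff_fg.2 h, locallyFinite_of_injective (f := M'.subtype) M'.injective_subtype hM⟩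

lemma muSmall_mono [IsNoetherianRing R] {M₁ M₂ : Submodule (MvPolynomial (Fin k) R) M}
    (h : M₁ ≤ M₂) (hM : IsSmall k L M₂) : monLE (muSmall k L M₁) (muSmall k L M₂) := by
  rw [muSmall_eq_mOplusE (f := Submodule.inclusion h)
    (g := (LinearMap.range (Submodule.inclusion h)).mkQ) (Submodule.inclusion_injective h)
    (Submodule.mkQ_surjective _) (Submodule.ker_mkQ _).symm hM]
  exact monLE_mOplusE_left _ _

lemma muSmall_monLE_muGen [IsNoetherianRing R] {M' : Submodule (MvPolynomial (Fin k) R) M}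
    (hM' : IsSmall k L M') : monLE (muSmall k L M') (muGen k L M) :=
  monLE_monSup (d := k) (by rintro _ ⟨M', h, rfl⟩; exact h.muSmall_fst_le) ⟨M', hM', rfl⟩

lemma muGen_monLE [IsNoetherianRing R] {b : ℕ × ℝ≥0∞}
    (h : ∀ M' : Submodule (MvPolynomial (Fin k) R) M, IsSmall k L M' →
      monLE (muSmall k L M') b) : monLE (muGen k L M) b := by
  refine monSup_monLE (d := k) (by rintro _ ⟨M', h, rfl⟩; exact h.muSmall_fst_le) ?_ ?_
  · refine ⟨_, ⊥, ⟨Module.Finite.iff_fg.2 Submodule.fg_bot, fun V _ => ?_⟩, rfl⟩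
    rw [L.l_zero V inferInstance]
    exact ENNReal.zero_lt_top
  · rintro _ ⟨M', h', rfl⟩
    exact h M' h'

end Small

/-- Addition theorem: Let `R` be a Noetherian commutative ring, `λ` a length
function on `R`-modules, `S = R[x₁,…,x_k]`, and `0 → A → B → C → 0` an exact sequence of
`S`-modules with `B` locally λ_R-finite.  Then `μ(B) = μ(A) ⊕ μ(C)`, where `μ` of an arbitrary
`S`-module is the supremum of `μ(M')` over its λ_S-small submodules `M'`. -/
theorem stmt_13 {k : ℕ} (L : LengthFunction R)
    {A B C : Type} [AddCommGroup A] [Module R A]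
    [Module (MvPolynomial (Fin k) R) A] [IsScalarTower R (MvPolynomial (Fin k) R) A]
    [AddCommGroup B] [Module R B]
    [Module (MvPolynomial (Fin k) R) B] [IsScalarTower R (MvPolynomial (Fin k) R) B]
    [AddCommGroup C] [Module R C]
    [Module (MvPolynomial (Fin k) R) C] [IsScalarTower R (MvPolynomial (Fin k) R) C]
    [IsNoetherianRing R]
    (f : A →ₗ[MvPolynomial (Fin k) R] B) (g : B →ₗ[MvPolynomial (Fin k) R] C)
    (hf : Function.Injective f) (hg : Function.Surjective g)
    (hfg : LinearMap.range f = LinearMap.ker g)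
    (hBloc : ∀ V : Submodule R B, V.FG → L.l V < ⊤) :
    muGen k L B = mOplusE (muGen k L A) (muGen k L C) := by
  have hAloc := locallyFinite_of_injective hf hBloc
  have hCloc := locallyFinite_of_surjective hg hBloc
  have hker (b : B) : g b = 0 ↔ ∃ a, f a = b := by
    rw [← LinearMap.mem_ker, ← hfg, LinearMap.mem_range]
  have hsub (B' : Submodule (MvPolynomial (Fin k) R) B) (hB' : B'.FG) :
      muSmall k L B' = mOplusE (muSmall k L (B'.comap f)) (muSmall k L (B'.map g)) := by
    refine muSmall_eq_mOplusE (f := f.restrict (p := B'.comap f) (q := B') fun a ha => ha)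
      (g := g.restrict (p := B') (q := B'.map g) fun b hb => ⟨b, hb, rfl⟩)
      (fun a a' h => Subtype.ext (hf (congrArg Subtype.val h))) ?_ ?_ (isSmall_of_fg hBloc hB')
    · rintro ⟨_, b, hb, rfl⟩
      exact ⟨⟨b, hb⟩, rfl⟩
    · ext ⟨b, hb⟩
      rw [LinearMap.mem_ker, LinearMap.mem_range]
      constructor
      · rintro ⟨⟨a, ha⟩, h⟩
        exact Subtype.ext ((hker b).2 ⟨a, congrArg Subtype.val h⟩)
      · intro h
        obtain ⟨a, rfl⟩ := (hker b).1 (congrArg Subtype.val h)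
        exact ⟨⟨a, hb⟩, rfl⟩
  have hcomap (B' : Submodule (MvPolynomial (Fin k) R) B) (hB' : B'.FG) : (B'.comap f).FG := by
    refine Submodule.fg_of_fg_map_injective f hf ?_
    exact Submodule.FG.of_le hB' (Submodule.map_comap_le f B')
  refine monLE.antisymm ?_ ?_
  · refine muGen_monLE fun B' hB' => ?_
    have hfg := Module.Finite.iff_fg.1 hB'.1
    rw [hsub B' hfg]
    exact mOplusE_mono (muSmall_monLE_muGen (isSmall_of_fg hAloc (hcomap B' hfg)))
      (muSmall_monLE_muGen (isSmall_of_fg hCloc (hfg.map g)))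
  · refine mOplusE_monSup_monLE (d := k) ?_ ?_ ?_ ?_ ?_
    · rintro _ ⟨A', hA', rfl⟩
      exact hA'.muSmall_fst_le
    · rintro _ ⟨C', hC', rfl⟩
      exact hC'.muSmall_fst_le
    · exact ⟨_, ⊥, isSmall_of_fg hAloc Submodule.fg_bot, rfl⟩
    · exact ⟨_, ⊥, isSmall_of_fg hCloc Submodule.fg_bot, rfl⟩
    · rintro _ ⟨A', hA', rfl⟩ _ ⟨C', hC', rfl⟩
      have hAfg := Module.Finite.iff_fg.1 hA'.1
      obtain ⟨B₀, hB₀, rfl⟩ := exists_fg_map_eq hg (Module.Finite.iff_fg.1 hC'.1)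
      have hB' : (A'.map f ⊔ B₀).FG := (hAfg.map f).sup hB₀
      have hmap : (A'.map f ⊔ B₀).map g = B₀.map g := by
        have : (A'.map f).map g = ⊥ := by
          rw [eq_bot_iff]
          rintro _ ⟨_, ⟨a, -, rfl⟩, rfl⟩
          exact (hker _).2 ⟨a, rfl⟩
        rw [Submodule.map_sup, this, bot_sup_eq]
      have h := hsub _ hB'
      rw [hmap] at h
      refine monLE.trans ?_ (muSmall_monLE_muGen (isSmall_of_fg hBloc hB'))
      rw [h]
      exact mOplusE_mono (muSmall_mono (Submodule.map_le_iff_le_comap.1 le_sup_left)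
        (isSmall_of_fg hAloc (hcomap _ hB'))) (Or.inr ⟨rfl, le_rfl⟩)
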